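/- A noetherian local ring A is regular if and only if there exists a test module for A of finite projective dimension. -/

import Mathlib

open CategoryTheory IsLocalRing

universe u

/-! ## Homological dimensions -/

/-- Flat dimension at most `n`: `M` is flat, or there is a surjection from a flat
module whose kernel has flat dimension at most `n - 1`. -/
def FlatDimLE (A : Type u) [CommRing A] :
    ℕ → ∀ (M : Type u) [AddCommGroup M] [Module A M], Prop
  | 0 => fun M _ _ => Module.Flat A M
  | n + 1 => fun M _ _ =>
      ∃ (F : Type u) (_ : AddCommGroup F) (_ : Module A F), Module.Flat A F ∧
        ∃ f : F →ₗ[A] M, Function.Surjective f ∧ FlatDimLE A n (LinearMap.ker f)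

/-- Projective dimension at most `n`. -/
def ProjDimLE (A : Type u) [CommRing A] :
    ℕ → ∀ (M : Type u) [AddCommGroup M] [Module A M], Prop
  | 0 => fun M _ _ => Module.Projective A M
  | n + 1 => fun M _ _ =>
      ∃ (P : Type u) (_ : AddCommGroup P) (_ : Module A P), Module.Projective A P ∧
        ∃ f : P →ₗ[A] M, Function.Surjective f ∧ ProjDimLE A n (LinearMap.ker f)

/-- Injective dimension at most `n`. -/
def InjDimLE (A : Type u) [CommRing A] :
    ℕ → ∀ (M : Type u) [AddCommGroup M] [Module A M], Prop
  | 0 => fun M _ _ => Module.Injective A M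
  | n + 1 => fun M _ _ =>
      ∃ (I : Type u) (_ : AddCommGroup I) (_ : Module A I), Module.Injective A I ∧
        ∃ f : M →ₗ[A] I, Function.Injective f ∧ InjDimLE A n (I ⧸ LinearMap.range f)

/-! ## Classes of local rings -/

/-- A Gorenstein (noetherian) local ring: a noetherian local ring having finite injective
dimension as a module over itself. -/
def IsGorensteinLocalRing (A : Type u) [CommRing A] : Prop :=
  IsNoetherianRing A ∧ IsLocalRing A ∧ ∃ n : ℕ, InjDimLE A n A

/-- A regular local ring: a noetherian local ring whose maximal ideal is generated by
`dim A` elements. -/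
def IsRegularLocal (A : Type u) [CommRing A] : Prop :=
  IsNoetherianRing A ∧ IsLocalRing A ∧
    ∃ s : Finset A, (Ideal.span (s : Set A)).IsMaximal ∧
      (s.card : WithBot ℕ∞) = ringKrullDim A

/-- A deformation: a surjective ring homomorphism whose kernel is generated by a
regular sequence. -/
def IsDeformation {Q A' : Type u} [CommRing Q] [CommRing A'] (f : Q →+* A') : Prop :=
  Function.Surjective f ∧
    ∃ rs : List Q, RingTheory.Sequence.IsRegular Q rs ∧
      RingHom.ker f = Ideal.span {x | x ∈ rs}

/-- A noetherian local ring is complete intersection if its `m`-adic completion is a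
quotient of a regular local ring by an ideal generated by a regular sequence. -/
def IsCompleteIntersectionLocalRing (A : Type u) [CommRing A] [IsLocalRing A] : Prop :=
  ∃ (Q : Type u) (_ : CommRing Q), IsRegularLocal Q ∧
    ∃ f : Q →+* AdicCompletion (maximalIdeal A) A, IsDeformation f

/-! ## Tor, test modules -/

/-- Vanishing of `Tor_i^A(M, N)`. -/
def TorVanish (A : Type u) [CommRing A] (i : ℕ)
    (M : Type u) [AddCommGroup M] [Module A M]
    (N : Type u) [AddCommGroup N] [Module A N] : Prop :=
  Subsingleton (((Tor (ModuleCat.{u} A) i).obj (ModuleCat.of A M)).obj (ModuleCat.of A N))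

/-- `M` is a test module for `A`: for every local homomorphism `A → B` of noetherian local
rings and every finitely generated `B`-module `N`, vanishing of `Tor_i^A(M,N)` for all
`i ≫ 0` implies that `N` has finite flat dimension over `A`. -/
def IsTestModule (A : Type u) [CommRing A] [IsLocalRing A] [IsNoetherianRing A]
    (M : Type u) [AddCommGroup M] [Module A M] : Prop :=
  ∀ (B : Type u) [CommRing B] [IsLocalRing B] [IsNoetherianRing B] [Algebra A B],
    IsLocalHom (algebraMap A B) →
    ∀ (N : Type u) [AddCommGroup N] [Module A N] [Module B N] [IsScalarTower A B N],
      Module.Finite B N →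
      (∃ i₀ : ℕ, ∀ i ≥ i₀, TorVanish A i M N) →
      ∃ n : ℕ, FlatDimLE A n N

/-- `M` is a Test module for `A`: for every finitely generated `A`-module `N`, vanishing of
`Tor_i^A(M,N)` for all `i ≫ 0` implies that `N` has finite flat dimension over `A`. -/
def IsCapitalTestModule (A : Type u) [CommRing A] [IsLocalRing A] [IsNoetherianRing A]
    (M : Type u) [AddCommGroup M] [Module A M] : Prop :=
  ∀ (N : Type u) [AddCommGroup N] [Module A N], Module.Finite A N →
    (∃ i₀ : ℕ, ∀ i ≥ i₀, TorVanish A i M N) →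
    ∃ n : ℕ, FlatDimLE A n N

/-! ## Weakly regular homomorphisms and upper CI dimension -/

/-- `A → A'` (given as an algebra) is a weakly regular local homomorphism: it is a local
homomorphism, flat, and the closed fiber `A' ⊗_A k = A'/m A'` is a regular local ring. -/
def IsWeaklyRegularAlgebra (A : Type u) [CommRing A] [IsLocalRing A]
    (A' : Type u) [CommRing A'] [Algebra A A'] : Prop :=
  IsLocalHom (algebraMap A A') ∧ Module.Flat A A' ∧
    IsRegularLocal (A' ⧸ Ideal.map (algebraMap A A') (maximalIdeal A))

/-- `M` has finite upper complete intersection dimension `CI*-dim_A(M) < ∞`: there are a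
weakly regular homomorphism `A → A'` of noetherian local rings and a deformation `Q → A'`
such that `pd_Q (A' ⊗_A M) < ∞`. -/
def CIStarDimFinite (A : Type u) [CommRing A] [IsLocalRing A]
    (M : Type u) [AddCommGroup M] [Module A M] : Prop :=
  ∃ (A' : Type u) (_ : CommRing A') (_ : IsLocalRing A') (_ : IsNoetherianRing A')
    (_ : Algebra A A'), IsWeaklyRegularAlgebra A A' ∧
    ∃ (Q : Type u) (_ : CommRing Q) (_ : IsLocalRing Q) (_ : IsNoetherianRing Q)
      (f : Q →+* A'), IsDeformation f ∧
        ∃ n : ℕ,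
          let _inst : Module Q (TensorProduct A A' M) :=
            Module.compHom (TensorProduct A A' M) f
          ProjDimLE Q n (TensorProduct A A' M)

/-! ## Gorenstein dimension -/

/-- Vanishing of `Ext^i_A(M, N)`. -/
def ExtVanish (A : Type u) [CommRing A] (i : ℕ)
    (M : Type u) [AddCommGroup M] [Module A M]
    (N : Type u) [AddCommGroup N] [Module A N] : Prop :=
  Subsingleton (((Ext A (ModuleCat.{u} A) i).obj (Opposite.op (ModuleCat.of A M))).obj
    (ModuleCat.of A N))

/-- `G-dim_A M = 0`: the biduality map is an isomorphism and
`Ext^i(M, A) = 0 = Ext^i(M*, A)` for `i > 0`. -/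
def GDimZero (A : Type u) [CommRing A] (M : Type u) [AddCommGroup M] [Module A M] : Prop :=
  Function.Bijective (Module.Dual.eval A M) ∧
    (∀ i > 0, ExtVanish A i M A) ∧
    (∀ i > 0, ExtVanish A i (Module.Dual A M) A)

/-- `G-dim_A M ≤ n`: `M` admits a resolution of length `n` by modules of G-dimension `0`. -/
def GDimLE (A : Type u) [CommRing A] :
    ℕ → ∀ (M : Type u) [AddCommGroup M] [Module A M], Prop
  | 0 => fun M _ _ => GDimZero A M
  | n + 1 => fun M _ _ =>
      ∃ (T : Type u) (_ : AddCommGroup T) (_ : Module A T), GDimZero A T ∧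
        ∃ f : T →ₗ[A] M, Function.Surjective f ∧ GDimLE A n (LinearMap.ker f)

/-! ## Complexity -/

/-- The length of a module: the length of the longest chain in its lattice of submodules.
For a module annihilated by the maximal ideal (such as `Tor_n^A(M, k)`) this is its
dimension as a `k`-vector space. -/
noncomputable def moduleLength (A : Type u) [CommRing A]
    (M : Type u) [AddCommGroup M] [Module A M] : WithBot ℕ∞ :=
  Order.krullDim (Submodule A M)

/-- `cx_A(M) ≤ c`: there exists a real `α` with
`dim_k Tor_n^A(M, k) ≤ α n^(c-1)` for all `n ≫ 0`. -/
def ComplexityLE (A : Type u) [CommRing A] [IsLocalRing A]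
    (M : Type u) [AddCommGroup M] [Module A M] (c : ℕ) : Prop :=
  ∃ α : ℝ, ∃ n₀ : ℕ, ∀ n ≥ n₀, ∃ d : ℕ,
    moduleLength A
      (((Tor (ModuleCat.{u} A) n).obj (ModuleCat.of A M)).obj
        (ModuleCat.of A (ResidueField A))) = (d : ℕ∞) ∧
      (d : ℝ) ≤ α * (n : ℝ) ^ ((c : ℤ) - 1)

/-- The complexity `cx_A(M)`: the least `c` as above. -/
noncomputable def complexity (A : Type u) [CommRing A] [IsLocalRing A]
    (M : Type u) [AddCommGroup M] [Module A M] : ℕ :=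
  sInf {c : ℕ | ComplexityLE A M c}

/-- The embedding dimension `dim_k m/m²` of a local ring. -/
noncomputable def embDim (A : Type u) [CommRing A] [IsLocalRing A] : ℕ :=
  Module.finrank (ResidueField A) (CotangentSpace A)


section PD
variable {A : Type u} [CommRing A]

theorem pd_zero_iff (M : Type u) [AddCommGroup M] [Module A M] :
    HasProjectiveDimensionLE (ModuleCat.of A M) 0 ↔ Module.Projective A M := by
  rw [← projective_iff_hasProjectiveDimensionLE_zero, ← IsProjective.iff_projective]

theorem pd_succ_iff {K F M : Type u} [AddCommGroup K] [Module A K] [AddCommGroup F] [Module A F]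
    [AddCommGroup M] [Module A M] (f : K →ₗ[A] F) (g : F →ₗ[A] M) (hf : Function.Injective f)
    (hfg : Function.Exact f g) (hg : Function.Surjective g) [Module.Projective A F] (n : ℕ) :
    HasProjectiveDimensionLE (ModuleCat.of A M) (n + 1) ↔
      HasProjectiveDimensionLE (ModuleCat.of A K) n := by
  let S : ShortComplex (ModuleCat.{u} A) :=
    ModuleCat.shortComplexOfCompEqZero f g hfg.linearMap_comp_eq_zero
  have hS : S.ShortExact :=
    { exact := (ShortComplex.ShortExact.moduleCat_exact_iff_function_exact _).mpr hfg
      mono_f := (ModuleCat.mono_iff_injective _).mpr hf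
      epi_g := (ModuleCat.epi_iff_surjective _).mpr hg }
  have : Projective S.X₂ := (IsProjective.iff_projective F).mp inferInstance
  exact hS.hasProjectiveDimensionLT_X₃_iff n this

theorem pd_ker_iff {F M : Type u} [AddCommGroup F] [Module A F]
    [AddCommGroup M] [Module A M] (g : F →ₗ[A] M)
    (hg : Function.Surjective g) [Module.Projective A F] (n : ℕ) :
    HasProjectiveDimensionLE (ModuleCat.of A M) (n + 1) ↔
      HasProjectiveDimensionLE (ModuleCat.of A (LinearMap.ker g)) n :=
  pd_succ_iff (LinearMap.ker g).subtype g (Submodule.injective_subtype _)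
    (fun x => by simp) hg n

theorem pd_mono {M : Type u} [AddCommGroup M] [Module A M] {m n : ℕ} (h : m ≤ n)
    (hm : HasProjectiveDimensionLE (ModuleCat.of A M) m) :
    HasProjectiveDimensionLE (ModuleCat.of A M) n :=
  hasProjectiveDimensionLT_of_ge _ (m + 1) (n + 1) (by omega)


/-- a finite free cover in the same universe -/
theorem exists_cover (M : Type u) [AddCommGroup M] [Module A M] [Module.Finite A M] :
    ∃ (n : ℕ) (f : (Fin n → A) →ₗ[A] M), Function.Surjective f :=
  Module.Finite.exists_fin' A M

theorem pd_quot_iff [IsLocalRing A] [IsNoetherianRing A] {x : A} (hx : x ∈ maximalIdeal A)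
    (hxA : IsSMulRegular A x) (n : ℕ) :
    ∀ (M : Type u) [AddCommGroup M] [Module A M] [Module.Finite A M], IsSMulRegular M x →
    (HasProjectiveDimensionLE (ModuleCat.of (A ⧸ Ideal.span {x}) (QuotSMulTop x M)) n ↔
      HasProjectiveDimensionLE (ModuleCat.of A M) n) := by
  have : Nontrivial (A ⧸ Ideal.span {x}) := Ideal.Quotient.nontrivial_iff.mpr
    (fun h => (Ideal.span_singleton_eq_top.mp h |> (mem_maximalIdeal x).mp hx))
  have : IsLocalRing (A ⧸ Ideal.span {x}) :=
    IsLocalRing.of_surjective' (Ideal.Quotient.mk _) Ideal.Quotient.mk_surjective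
  induction n with
  | zero =>
    intro M _ _ _ hM
    have : Module.Finite (A ⧸ Ideal.span {x}) (QuotSMulTop x M) :=
      Module.Finite.of_restrictScalars_finite A _ _
    rw [pd_zero_iff, pd_zero_iff]
    have := Module.finitePresentation_of_finite A M
    have h1 := Module.free_quotSMulTop_iff_free A M (x := x)
      (IsLocalRing.maximalIdeal_le_jacobson _ hx) hM
    constructor
    · intro h
      have : Module.Free (A ⧸ Ideal.span {x}) (QuotSMulTop x M) :=
        Module.free_of_flat_of_isLocalRing
      have := h1.mp this
      infer_instance
    · intro h
      have : Module.Free A M := Module.free_of_flat_of_isLocalRing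
      infer_instance
  | succ n ih =>
    intro M _ _ _ hM
    obtain ⟨r, f, hf⟩ := exists_cover (A := A) M
    have hF : IsSMulRegular (Fin r → A) x := IsSMulRegular.pi (fun _ => hxA)
    have hK : IsSMulRegular (LinearMap.ker f) x := hF.submodule _ _
    rw [pd_ker_iff f hf, ← ih _ hK]
    have hex : Function.Exact (LinearMap.ker f).subtype f := fun x => by simp
    have h0 : Function.Exact (0 : PUnit.{u+1} →ₗ[A] LinearMap.ker f) (LinearMap.ker f).subtype := by
      rw [LinearMap.exact_zero_iff_injective]; exact Submodule.injective_subtype _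
    have e2 := QuotSMulTop.map_exact x hex hf
    have e1 := QuotSMulTop.map_first_exact_on_four_term_exact_of_isSMulRegular_last (r := x)
      h0 hex hM
    have hsur : Function.Surjective (algebraMap A (A ⧸ Ideal.span {x})) :=
      Ideal.Quotient.mk_surjective
    refine pd_succ_iff
      ((QuotSMulTop.map x (LinearMap.ker f).subtype).extendScalarsOfSurjective hsur)
      ((QuotSMulTop.map x f).extendScalarsOfSurjective hsur) ?_ e2
      (QuotSMulTop.map_surjective x hf) n
    rw [map_zero, LinearMap.exact_zero_iff_injective] at e1
    exact e1
end PD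

section Glob
open Abelian
variable {A : Type u} [CommRing A]

theorem injdim_of_ideals (n : ℕ) : ∀ (Y : ModuleCat.{u} A),
    (∀ I : Ideal A, Subsingleton (Ext (ModuleCat.of A (A ⧸ I)) Y (n + 1))) →
    HasInjectiveDimensionLT Y (n + 1) := by
  induction n with
  | zero =>
    intro Y h
    rw [zero_add, ← injective_iff_hasInjectiveDimensionLT_one,
      ← Module.injective_iff_injective_object]
    apply Module.Baer.injective
    intro I g
    let S : ShortComplex (ModuleCat.{u} A) :=
      ModuleCat.shortComplexOfCompEqZero (I.subtype) (Submodule.mkQ I)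
        (by ext x; simp [Ideal.Quotient.eq_zero_iff_mem])
    have hS : S.ShortExact :=
      { exact := (ShortComplex.ShortExact.moduleCat_exact_iff_function_exact _).mpr
          (fun x => by simp [S, Ideal.Quotient.eq_zero_iff_mem])
        mono_f := (ModuleCat.mono_iff_injective _).mpr (Submodule.injective_subtype _)
        epi_g := (ModuleCat.epi_iff_surjective _).mpr (Submodule.mkQ_surjective _) }
    have := h I
    obtain ⟨φ, hφ⟩ := Ext.contravariant_sequence_exact₁ hS Y
      (Ext.mk₀ (ModuleCat.ofHom g : S.X₁ ⟶ Y)) (n₁ := 1) (add_zero 1)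
      (Subsingleton.elim (α := Ext (ModuleCat.of A (A ⧸ I)) Y 1) _ _)
    obtain ⟨φ, rfl⟩ := Ext.homEquiv₀.symm.surjective φ
    have hφ' : S.f ≫ φ = ModuleCat.ofHom g :=
      Ext.homEquiv₀.symm.injective (by simpa using hφ)
    refine ⟨φ.hom, fun x hx => ?_⟩
    have := LinearMap.congr_fun (congrArg ModuleCat.Hom.hom hφ') ⟨x, hx⟩
    simpa [S] using this
  | succ n ih =>
    intro Y h
    let ⟨p⟩ := EnoughInjectives.presentation Y
    have hS : (ShortComplex.mk _ _ (Limits.cokernel.condition p.f)).ShortExact :=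
      { exact := ShortComplex.exact_cokernel p.f }
    refine (hS.hasInjectiveDimensionLT_X₃_iff n p.injective).mp (ih _ fun I => ?_)
    refine ⟨fun a b => ?_⟩
    have key : ∀ a : Ext (ModuleCat.of A (A ⧸ I)) (Limits.cokernel p.f) (n+1), a = 0 := by
      intro a
      have := h I
      obtain ⟨x, rfl⟩ := Ext.covariant_sequence_exact₃ _ hS a (n₁ := n + 2) rfl
        (Subsingleton.elim (α := Ext (ModuleCat.of A (A ⧸ I)) Y (n+2)) _ _)
      have := p.injective
      rw [show x = 0 from Ext.eq_zero_of_injective (I := p.J) x, Ext.zero_comp]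
    rw [key a, key b]

theorem pd_of_ideals (n : ℕ)
    (h : ∀ I : Ideal A, HasProjectiveDimensionLE (ModuleCat.of A (A ⧸ I)) n)
    (M : Type u) [AddCommGroup M] [Module A M] :
    HasProjectiveDimensionLE (ModuleCat.of A M) n := by
  rw [HasProjectiveDimensionLE, hasProjectiveDimensionLT_iff]
  intro i hi Y e
  have : HasInjectiveDimensionLT Y (n + 1) := injdim_of_ideals n Y fun I =>
    have := h I
    HasProjectiveDimensionLT.subsingleton _ (n+1) _ le_rfl _
  exact e.eq_zero_of_hasInjectiveDimensionLT (n+1) hi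
end Glob


section FD
variable {A : Type u} [CommRing A]

theorem flatDimLE_of_pd (n : ℕ) : ∀ (M : Type u) [AddCommGroup M] [Module A M],
    HasProjectiveDimensionLE (ModuleCat.of A M) n → FlatDimLE A n M := by
  induction n with
  | zero =>
    intro M _ _ h
    have := (pd_zero_iff M).mp h
    exact (inferInstance : Module.Flat A M)
  | succ n ih =>
    intro M _ _ h
    have hs : Function.Surjective (Finsupp.linearCombination A (id : M → M)) := fun m =>
      ⟨Finsupp.single m 1, by simp⟩
    exact ⟨M →₀ A, inferInstance, inferInstance, inferInstance,
      Finsupp.linearCombination A (id : M → M), hs, ih _ ((pd_ker_iff _ hs n).mp h)⟩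

theorem FlatDimLE.of_equiv (n : ℕ) {M N : Type u} [AddCommGroup M] [Module A M]
    [AddCommGroup N] [Module A N] (e : M ≃ₗ[A] N) (h : FlatDimLE A n M) : FlatDimLE A n N := by
  cases n with
  | zero =>
    have : Module.Flat A M := h
    exact Module.Flat.of_linearEquiv e.symm
  | succ n =>
    obtain ⟨F, _, _, hF, f, hf, hk⟩ := h
    refine ⟨F, _, _, hF, e.toLinearMap ∘ₗ f, e.surjective.comp hf, ?_⟩
    rwa [LinearEquiv.ker_comp]

theorem FlatDimLE.ker_flat (n : ℕ) {E F : Type u} [AddCommGroup E] [Module A E]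
    [AddCommGroup F] [Module A F] [Module.Flat A F] (g : E →ₗ[A] F) (hg : Function.Surjective g)
    (h : FlatDimLE A n E) : FlatDimLE A n (LinearMap.ker g) := by
  have key : ∀ {E : Type u} [AddCommGroup E] [Module A E] [Module.Flat A E] (g : E →ₗ[A] F)
      (_ : Function.Surjective g), Module.Flat A (LinearMap.ker g) := by
    intro E _ _ _ g hg
    rw [Module.Flat.iff_rTensor_preserves_injective_linearMap]
    intro N N' _ _ _ _ f hf
    have h1 := LinearMap.lTensor_injective_of_exact_of_flat g hg (LinearMap.ker g).subtype
      Subtype.val_injective (LinearMap.exact_subtype_ker_map g) N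
    have h2 := Module.Flat.rTensor_preserves_injective_linearMap (M := E) f hf
    have h3 : Function.Injective ((LinearMap.ker g).subtype.lTensor N' ∘ₗ f.rTensor _) := by
      rw [LinearMap.lTensor_comp_rTensor, ← LinearMap.rTensor_comp_lTensor]
      exact h2.comp h1
    rw [LinearMap.coe_comp] at h3
    exact h3.of_comp
  cases n with
  | zero =>
    have : Module.Flat A E := h
    exact key g hg
  | succ n =>
    obtain ⟨G, _, _, hG, f, hf, hk⟩ := h
    refine ⟨LinearMap.ker (g ∘ₗ f), _, _, key _ (hg.comp hf),
      f.restrict (fun x hx => by simpa using hx), ?_, ?_⟩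
    · rintro ⟨y, hy⟩
      obtain ⟨x, rfl⟩ := hf y
      exact ⟨⟨x, by simpa using hy⟩, rfl⟩
    · refine FlatDimLE.of_equiv n (LinearEquiv.ofBijective
        (LinearMap.codRestrict _ (LinearMap.codRestrict (LinearMap.ker (g ∘ₗ f))
          (LinearMap.ker f).subtype (fun x => by simp)) (fun x => LinearMap.mem_ker.mpr (Subtype.ext (LinearMap.mem_ker.mp x.2)))) ⟨?_, ?_⟩) hk
      · intro x y hxy
        ext
        exact congrArg (fun z => (z.1.1 : G)) hxy
      · rintro ⟨⟨x, hx⟩, hx'⟩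
        exact ⟨⟨x, congrArg Subtype.val (LinearMap.mem_ker.mp hx')⟩, rfl⟩

theorem flat_prod (K P : Type u) [AddCommGroup K] [Module A K]
    [AddCommGroup P] [Module A P] [Module.Flat A K] [Module.Flat A P] :
    Module.Flat A (K × P) := by
  rw [Module.Flat.iff_rTensor_preserves_injective_linearMap]
  intro N N' _ _ _ _ f hf
  rw [← LinearMap.ker_eq_bot, LinearMap.ker_eq_bot']
  intro z hz
  have h1 : (LinearMap.fst A K P).lTensor N z = 0 := by
    apply Module.Flat.rTensor_preserves_injective_linearMap (M := K) f hf
    rw [map_zero, ← LinearMap.comp_apply, LinearMap.rTensor_comp_lTensor,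
      ← LinearMap.lTensor_comp_rTensor, LinearMap.comp_apply, hz, map_zero]
  have h2 : (LinearMap.snd A K P).lTensor N z = 0 := by
    apply Module.Flat.rTensor_preserves_injective_linearMap (M := P) f hf
    rw [map_zero, ← LinearMap.comp_apply, LinearMap.rTensor_comp_lTensor,
      ← LinearMap.lTensor_comp_rTensor, LinearMap.comp_apply, hz, map_zero]
  have h3 : (LinearMap.inl A K P ∘ₗ LinearMap.fst A K P +
      LinearMap.inr A K P ∘ₗ LinearMap.snd A K P) = LinearMap.id := by
    ext <;> simp
  have h4 := congrArg (fun φ => LinearMap.lTensor N φ z) h3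
  simpa [LinearMap.lTensor_add, LinearMap.lTensor_comp, h1, h2] using h4.symm

theorem FlatDimLE.prod_flat (n : ℕ) {K P : Type u} [AddCommGroup K] [Module A K]
    [AddCommGroup P] [Module A P] [Module.Flat A P]
    (h : FlatDimLE A n K) : FlatDimLE A n (K × P) := by
  cases n with
  | zero =>
    have : Module.Flat A K := h
    exact flat_prod K P
  | succ n =>
    obtain ⟨G, _, _, hG, f, hf, hk⟩ := h
    refine ⟨G × P, _, _, flat_prod G P, f.prodMap LinearMap.id, ?_, ?_⟩
    · exact hf.prodMap Function.surjective_id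
    · refine FlatDimLE.of_equiv n (LinearEquiv.ofBijective
        (LinearMap.codRestrict _ (LinearMap.inl A G P ∘ₗ (LinearMap.ker f).subtype)
          (fun x => by simp)) ⟨?_, ?_⟩) hk
      · intro x y hxy
        ext
        exact congrArg (fun z => (z.1.1 : G)) hxy
      · rintro ⟨⟨x, y⟩, hx⟩
        simp at hx
        exact ⟨⟨x, by simpa using hx.1⟩, Subtype.ext (Prod.ext rfl hx.2.symm)⟩

theorem FlatDimLE.syz (n : ℕ) {M P : Type u} [AddCommGroup M] [Module A M]
    [AddCommGroup P] [Module A P] [Module.Projective A P] (p : P →ₗ[A] M)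
    (hp : Function.Surjective p) (h : FlatDimLE A (n + 1) M) :
    FlatDimLE A n (LinearMap.ker p) := by
  obtain ⟨F, _, _, hF, f, hf, hk⟩ := h
  obtain ⟨s, hs⟩ := Module.projective_lifting_property f p hf
  have hs' : ∀ y, f (s y) = p y := fun y => LinearMap.congr_fun hs y
  let φ : (LinearMap.ker f × P) →ₗ[A] F := (LinearMap.ker f).subtype.coprod s
  have hφ : Function.Surjective φ := by
    intro z
    obtain ⟨y, hy⟩ := hp (f z)
    refine ⟨(⟨z - s y, by simp [hs', hy]⟩, y), by simp [φ]⟩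
  have h1 := FlatDimLE.ker_flat n φ hφ (FlatDimLE.prod_flat n hk)
  refine FlatDimLE.of_equiv n (LinearEquiv.ofBijective
    (LinearMap.codRestrict (LinearMap.ker p)
      (LinearMap.snd A _ _ ∘ₗ (LinearMap.ker φ).subtype) ?_) ⟨?_, ?_⟩) h1
  · rintro ⟨⟨⟨k, hk⟩, y⟩, hx⟩
    simp [φ] at hx hk ⊢
    rw [← hs', eq_neg_of_add_eq_zero_right hx, map_neg, hk, neg_zero]
  · rw [← LinearMap.ker_eq_bot, LinearMap.ker_eq_bot']
    rintro ⟨⟨⟨k, hk⟩, y⟩, hx⟩ h0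
    have hy : y = 0 := congrArg Subtype.val h0
    subst hy
    simp [φ] at hx
    subst hx
    rfl
  · rintro ⟨y, hy⟩
    exact ⟨⟨(⟨-s y, by simpa [hs'] using hy⟩, y), by simp [φ]⟩, rfl⟩

theorem pd_of_flatDimLE [IsLocalRing A] [IsNoetherianRing A] (n : ℕ) :
    ∀ (M : Type u) [AddCommGroup M] [Module A M] [Module.Finite A M],
    FlatDimLE A n M → HasProjectiveDimensionLE (ModuleCat.of A M) n := by
  induction n with
  | zero =>
    intro M _ _ _ h
    have : Module.Flat A M := h
    have := Module.free_of_flat_of_isLocalRing (R := A) (P := M)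
    exact (pd_zero_iff M).mpr inferInstance
  | succ n ih =>
    intro M _ _ _ h
    obtain ⟨r, f, hf⟩ := exists_cover (A := A) M
    rw [pd_ker_iff f hf]
    exact ih _ (FlatDimLE.syz n f hf h)

end FD

section LR
variable {A : Type u} [CommRing A] [IsLocalRing A] [IsNoetherianRing A]

theorem isRegularLocal_iff : IsRegularLocal A ↔ IsRegularLocalRing A := by
  constructor
  · rintro ⟨_, _, s, hs, hc⟩
    have hs' := IsLocalRing.eq_maximalIdeal hs
    apply IsRegularLocalRing.of_spanFinrank_maximalIdeal_le
    rw [← hc, ← hs']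
    have := Submodule.spanFinrank_span_le_ncard_of_finite (R := A) (s.finite_toSet)
    rw [Set.ncard_coe_finset] at this
    exact_mod_cast this
  · intro h
    obtain ⟨s, hs, hs'⟩ := (IsNoetherian.noetherian (maximalIdeal A)).exists_span_finset_card_eq_spanFinrank
    refine ⟨inferInstance, inferInstance, s, ?_, ?_⟩
    · have : Ideal.span (s : Set A) = maximalIdeal A := by assumption
      rw [this]; infer_instance
    · rw [← (isRegularLocalRing_iff A).mp h]
      norm_cast

theorem quot_isLocal {x : A} (hx : x ∈ maximalIdeal A) : IsLocalRing (A ⧸ Ideal.span {x}) := by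
  have : Nontrivial (A ⧸ Ideal.span {x}) := Ideal.Quotient.nontrivial_iff.mpr
    (fun h => (Ideal.span_singleton_eq_top.mp h |> (mem_maximalIdeal x).mp hx))
  exact IsLocalRing.of_surjective' (Ideal.Quotient.mk _) Ideal.Quotient.mk_surjective

theorem comap_max {x : A} [IsLocalRing (A ⧸ Ideal.span {x})] :
    (maximalIdeal (A ⧸ Ideal.span {x})).comap (Ideal.Quotient.mk _) = maximalIdeal A :=
  IsLocalRing.eq_maximalIdeal
    (Ideal.comap_isMaximal_of_surjective _ Ideal.Quotient.mk_surjective)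

theorem map_max {x : A} [IsLocalRing (A ⧸ Ideal.span {x})] :
    (maximalIdeal A).map (Ideal.Quotient.mk (Ideal.span {x})) =
      maximalIdeal (A ⧸ Ideal.span {x}) := by
  rw [← comap_max (x := x), Ideal.map_comap_of_surjective _ Ideal.Quotient.mk_surjective]

theorem spanFinrank_quot_le {x : A} (hx : x ∈ maximalIdeal A) (hx2 : x ∉ maximalIdeal A ^ 2)
    [IsLocalRing (A ⧸ Ideal.span {x})] {n : ℕ} (hn : (maximalIdeal A).spanFinrank = n + 1) :
    (maximalIdeal (A ⧸ Ideal.span {x})).spanFinrank ≤ n := by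
  classical
  obtain ⟨s, hc, hs⟩ :=
    (IsNoetherian.noetherian (maximalIdeal A)).exists_span_finset_card_eq_spanFinrank
  rw [hn] at hc
  have hs : Ideal.span (s : Set A) = maximalIdeal A := hs
  have hx' := hx
  rw [← hs] at hx'
  obtain ⟨f, -, hf⟩ := Submodule.mem_span_finset.mp hx'
  have hmem : ∀ a ∈ s, a ∈ maximalIdeal A := fun a ha => hs ▸ Ideal.subset_span ha
  have : ∃ a ∈ s, IsUnit (f a) := by
    by_contra! h
    apply hx2
    rw [← hf, pow_two]
    exact Ideal.sum_mem _ fun a ha => Ideal.mul_mem_mul (h a ha) (hmem a ha)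
  obtain ⟨a, ha, hu⟩ := this
  have hgen : maximalIdeal A ≤ Ideal.span {x} ⊔ Ideal.span ((s.erase a : Finset A) : Set A) := by
    rw [← hs, Ideal.span_le]
    intro b hb
    by_cases hba : b = a
    · subst hba
      rw [← Finset.add_sum_erase s _ ha] at hf
      have h1 : f b • b = x - ∑ c ∈ s.erase b, f c • c := eq_sub_of_add_eq hf
      rw [SetLike.mem_coe, ← Ideal.unit_mul_mem_iff_mem _ hu, ← smul_eq_mul, h1]
      refine Ideal.sub_mem _ (Ideal.mem_sup_left (Ideal.mem_span_singleton_self x))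
        (Ideal.mem_sup_right (Ideal.sum_mem _ fun c hc => Ideal.mul_mem_left _ _
          (Ideal.subset_span hc)))
    · exact Ideal.mem_sup_right (Ideal.subset_span (Finset.mem_erase.mpr ⟨hba, hb⟩))
  have h2 : maximalIdeal (A ⧸ Ideal.span {x}) =
      Ideal.span (((s.erase a).image (Ideal.Quotient.mk (Ideal.span {x})) : Finset _) : Set _) := by
    apply le_antisymm
    · rw [← map_max]
      refine (Ideal.map_mono hgen).trans ?_
      rw [Ideal.map_sup, Ideal.map_span, Ideal.map_span, Finset.coe_image]
      refine sup_le ?_ le_rfl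
      rw [Set.image_singleton, Ideal.Quotient.eq_zero_iff_mem.mpr (Ideal.mem_span_singleton_self x)]
      simp
    · rw [Ideal.span_le, Finset.coe_image, ← map_max]
      rintro _ ⟨b, hb, rfl⟩
      exact Ideal.mem_map_of_mem _ (hmem b (Finset.mem_of_mem_erase hb))
  rw [h2]
  refine (Submodule.spanFinrank_span_le_ncard_of_finite (Finset.finite_toSet _)).trans ?_
  rw [Set.ncard_coe_finset]
  refine Finset.card_image_le.trans ?_
  rw [Finset.card_erase_of_mem ha, hc]; omega

theorem spanFinrank_le_quot {x : A} (hx : x ∈ maximalIdeal A)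
    [IsLocalRing (A ⧸ Ideal.span {x})] :
    (maximalIdeal A).spanFinrank ≤ (maximalIdeal (A ⧸ Ideal.span {x})).spanFinrank + 1 := by
  classical
  obtain ⟨s, hc, hs⟩ :=
    (IsNoetherian.noetherian (maximalIdeal (A ⧸ Ideal.span {x}))).exists_span_finset_card_eq_spanFinrank
  have hs : Ideal.span (s : Set (A ⧸ Ideal.span {x})) = maximalIdeal _ := hs
  have hout : ∀ y : A ⧸ Ideal.span {x}, Ideal.Quotient.mk _ (Quotient.out y) = y :=
    fun y => Quotient.out_eq y
  have h : maximalIdeal A = Ideal.span ((insert x (s.image Quotient.out) : Finset A) : Set A) := by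
    apply le_antisymm
    · rw [Finset.coe_insert, Ideal.span_insert]
      have h1 : (Ideal.span ((s.image Quotient.out : Finset A) : Set A)).map
          (Ideal.Quotient.mk (Ideal.span {x})) = maximalIdeal _ := by
        rw [Ideal.map_span, ← hs, Finset.coe_image, Set.image_image]
        simp [hout]
      rw [← comap_max (x := x), ← h1, Ideal.comap_map_of_surjective _ Ideal.Quotient.mk_surjective]
      rw [sup_comm]
      gcongr
      intro y hy
      simpa [Ideal.Quotient.eq_zero_iff_mem] using hy
    · rw [Ideal.span_le]
      intro y hy
      simp only [Finset.coe_insert, Finset.coe_image, Set.mem_insert_iff, Set.mem_image] at hy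
      rcases hy with rfl | ⟨z, hz, rfl⟩
      · exact hx
      · rw [SetLike.mem_coe, ← comap_max (x := x), Ideal.mem_comap, hout, ← hs]
        exact Ideal.subset_span hz
  rw [h]
  refine (Submodule.spanFinrank_span_le_ncard_of_finite (Finset.finite_toSet _)).trans ?_
  rw [Set.ncard_coe_finset]
  refine (Finset.card_insert_le _ _).trans ?_
  have := Finset.card_image_le (s := s) (f := (Quotient.out : A ⧸ Ideal.span {x} → A))
  omega

theorem exists_avoid (hm : maximalIdeal A ≠ ⊥) {S : Set (Ideal A)} (hS : S.Finite)
    (hp : ∀ p ∈ S, p.IsPrime) (hne : maximalIdeal A ∉ S) :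
    ∃ x ∈ maximalIdeal A, x ∉ maximalIdeal A ^ 2 ∧ ∀ p ∈ S, x ∉ p := by
  by_contra! h
  have h2 : maximalIdeal A ^ 2 ≠ ⊤ := fun h' =>
    Ideal.IsPrime.ne_top (inferInstance : (maximalIdeal A).IsPrime)
      (top_le_iff.mp (h' ▸ Ideal.pow_le_self two_ne_zero))
  have := (Ideal.subset_iUnion_iff_mem_of_isMaximal_of_finite (M := maximalIdeal A)
    (hS.insert (maximalIdeal A ^ 2)) (maximalIdeal A ^ 2) (maximalIdeal A ^ 2)
    (by
      intro I hI h1 _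
      rcases hI with rfl | hI
      · exact absurd rfl h1
      · exact hp I hI) h2 h2).mp ?_
  · rcases this with h3 | h3
    · apply hm
      have hfg : (maximalIdeal A).FG := IsNoetherian.noetherian _
      refine Submodule.eq_bot_of_le_smul_of_le_jacobson_bot (maximalIdeal A) _ hfg ?_
        (IsLocalRing.maximalIdeal_le_jacobson _)
      rw [smul_eq_mul, ← pow_two, ← h3]
    · exact hne h3
  · intro x hx
    by_cases hx2 : x ∈ maximalIdeal A ^ 2
    · exact Set.mem_biUnion (Set.mem_insert _ _) hx2
    · obtain ⟨p, hp, hxp⟩ := h x hx hx2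
      exact Set.mem_biUnion (Set.mem_insert_of_mem _ hp) hxp
end LR

section FW

theorem le_of_succ_le (n : ℕ) (d : WithBot ℕ∞) (h : (n : WithBot ℕ∞) + 1 ≤ d + 1) :
    (n : WithBot ℕ∞) ≤ d := by
  induction d using WithBot.recBotCoe with
  | bot => exact absurd h (by rw [WithBot.bot_add]; norm_cast)
  | coe d =>
    induction d using ENat.recTopCoe with
    | top => exact_mod_cast le_top
    | coe d =>
      norm_cast at h ⊢
      exact Nat.le_of_succ_le_succ h

theorem regular_main (n : ℕ) : ∀ (A : Type u) [CommRing A] [IsRegularLocalRing A],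
    (maximalIdeal A).spanFinrank = n → IsDomain A ∧ ∀ (M : Type u) [AddCommGroup M] [Module A M]
      [Module.Finite A M], HasProjectiveDimensionLE (ModuleCat.of A M) n := by
  induction n with
  | zero =>
    intro A _ _ h
    rw [Submodule.spanFinrank_eq_zero_iff_eq_bot (IsNoetherian.noetherian _)] at h
    have hf : IsField A := IsLocalRing.isField_iff_maximalIdeal_eq.mpr h
    refine ⟨hf.isDomain, fun M _ _ _ => ?_⟩
    rw [pd_zero_iff]
    let _ := hf.toField
    exact Module.Projective.of_free
  | succ n ih =>
    intro A _ _ h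
    have hdim : ((n + 1 : ℕ) : WithBot ℕ∞) = ringKrullDim A := by
      rw [← (isRegularLocalRing_iff A).mp inferInstance, h]
    have hm : maximalIdeal A ≠ ⊥ := fun h' => by simp [h'] at h
    have hmin : maximalIdeal A ∉ minimalPrimes A := by
      intro h'
      have h0 : (maximalIdeal A).height = 0 := Ideal.height_eq_zero_iff.mpr h'
      rw [← IsLocalRing.maximalIdeal_height_eq_ringKrullDim, h0] at hdim
      norm_cast at hdim
    obtain ⟨x, hx, hx2, hxp⟩ := exists_avoid hm (minimalPrimes.finite_of_isNoetherianRing A)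
      (fun p hp => hp.1.1) hmin
    have := quot_isLocal hx
    have hle := spanFinrank_quot_le hx hx2 h
    have hd : ringKrullDim A ≤ ringKrullDim (A ⧸ Ideal.span {x}) + 1 := by
      rw [← IsLocalRing.maximalIdeal_height_eq_ringKrullDim]
      exact Ideal.height_le_ringKrullDim_quotient_add_one hx
    have hd' : (n : WithBot ℕ∞) ≤ ringKrullDim (A ⧸ Ideal.span {x}) := by
      rw [← hdim] at hd
      push_cast at hd
      exact le_of_succ_le n _ hd
    have hreg : IsRegularLocalRing (A ⧸ Ideal.span {x}) := by
      apply IsRegularLocalRing.of_spanFinrank_maximalIdeal_le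
      exact le_trans (by exact_mod_cast hle) hd'
    have heq : (maximalIdeal (A ⧸ Ideal.span {x})).spanFinrank = n := by
      apply le_antisymm hle
      have := (isRegularLocalRing_iff (A ⧸ Ideal.span {x})).mp inferInstance
      rw [← this] at hd'
      exact_mod_cast hd'
    obtain ⟨hdom, hpd⟩ := ih _ heq
    have hprime : (Ideal.span {x}).IsPrime := (Ideal.Quotient.isDomain_iff_prime _).mp hdom
    obtain ⟨p, hp, hpx⟩ := Ideal.exists_minimalPrimes_le (bot_le : ⊥ ≤ Ideal.span {x})
    have hp0 : p = ⊥ := by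
      refine Submodule.eq_bot_of_le_smul_of_le_jacobson_bot (maximalIdeal A) _
        (IsNoetherian.noetherian _) ?_ (IsLocalRing.maximalIdeal_le_jacobson _)
      intro y hy
      obtain ⟨z, rfl⟩ := Ideal.mem_span_singleton.mp (hpx hy)
      have hpp : p.IsPrime := hp.1.1
      exact Ideal.mul_mem_mul hx ((hpp.mem_or_mem hy).resolve_left (hxp p hp))
    have hpp : p.IsPrime := hp.1.1
    rw [hp0] at hpp
    have hA : IsDomain A := IsDomain.of_bot_isPrime A
    refine ⟨hA, fun M _ _ _ => ?_⟩
    have hx0 : x ≠ 0 := fun h => hx2 (h ▸ Ideal.zero_mem _)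
    have hxA : IsSMulRegular A x := fun a b hab => mul_left_cancel₀ hx0 hab
    obtain ⟨r, f, hf⟩ := exists_cover (A := A) M
    rw [pd_ker_iff f hf, ← pd_quot_iff hx hxA n (LinearMap.ker f) ?_]
    · have : Module.Finite (A ⧸ Ideal.span {x}) (QuotSMulTop x (LinearMap.ker f)) :=
        Module.Finite.of_restrictScalars_finite A _ _
      exact hpd _
    · intro a b hab
      ext i
      exact hxA (congrFun (congrArg Subtype.val hab) i)

theorem forward (A : Type u) [CommRing A] [IsLocalRing A] [IsNoetherianRing A]
    (h : IsRegularLocal A) : ∃ (M : Type u) (_ : AddCommGroup M) (_ : Module A M),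
      Module.Finite A M ∧ IsTestModule A M ∧ ∃ n : ℕ, ProjDimLE A n M := by
  have hr := isRegularLocal_iff.mp h
  have := (regular_main _ A rfl).2
  refine ⟨A, inferInstance, inferInstance, inferInstance, ?_, 0,
    (inferInstance : Module.Projective A A)⟩
  intro B _ _ _ _ _ N _ _ _ _ _ _
  exact ⟨_, flatDimLE_of_pd _ N (pd_of_ideals _ (fun I => this (A ⧸ I)) N)⟩
end FW

section SE

theorem proj_of_socle {A : Type u} [CommRing A] [IsLocalRing A] [IsNoetherianRing A]
    {s : A} (hs : s ≠ 0) (hsm : ∀ a ∈ maximalIdeal A, s * a = 0) (n : ℕ) :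
    ∀ (M : Type u) [AddCommGroup M] [Module A M] [Module.Finite A M],
    HasProjectiveDimensionLE (ModuleCat.of A M) n → Module.Projective A M := by
  induction n with
  | zero => exact fun M _ _ _ h => (pd_zero_iff M).mp h
  | succ n ih =>
    intro M _ _ _ h
    obtain ⟨r, f, hf⟩ := exists_cover (A := A) M
    rw [pd_ker_iff f hf] at h
    have hK := ih _ h
    have hKf : Module.Free A (LinearMap.ker f) := Module.free_of_flat_of_isLocalRing
    have hinj : Function.Injective
        (((LinearMap.ker f).subtype).lTensor (A ⧸ maximalIdeal A)) := by
      rw [← LinearMap.ker_eq_bot, LinearMap.ker_eq_bot']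
      intro z hz
      obtain ⟨z, rfl⟩ := (TensorProduct.quotTensorEquivQuotSMul _ (maximalIdeal A)).symm.surjective z
      obtain ⟨v, rfl⟩ := Submodule.Quotient.mk_surjective _ z
      rw [TensorProduct.quotTensorEquivQuotSMul_symm_mk, LinearMap.lTensor_tmul] at hz
      have h1 := congrArg (TensorProduct.quotTensorEquivQuotSMul _ (maximalIdeal A)) hz
      rw [TensorProduct.quotTensorEquivQuotSMul_mk_one_tmul, map_zero,
        Submodule.Quotient.mk_eq_zero] at h1
      have h2 : s • (v : Fin r → A) = 0 := by
        have : (maximalIdeal A • ⊤ : Submodule A (Fin r → A)) ≤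
            LinearMap.ker (LinearMap.lsmul A (Fin r → A) s) := by
          rw [Submodule.smul_le]
          intro a ha w _
          rw [LinearMap.mem_ker, LinearMap.lsmul_apply, smul_smul, hsm a ha, zero_smul]
        exact this h1
      have h3 : s • v = 0 := Subtype.ext h2
      let b := Module.Free.chooseBasis A (LinearMap.ker f)
      have h4 : v ∈ (maximalIdeal A • ⊤ : Submodule A (LinearMap.ker f)) := by
        rw [← b.sum_repr v]
        refine Submodule.sum_mem _ fun i _ => Submodule.smul_mem_smul ?_ trivial
        rw [mem_maximalIdeal, mem_nonunits_iff]
        intro hu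
        have h5 : s * b.repr v i = 0 := by
          have := congrArg (fun w => b.repr w i) h3
          simpa using this
        exact hs (hu.mul_left_eq_zero.mp h5)
      rw [(Submodule.Quotient.mk_eq_zero _).mpr h4, map_zero]
    have := Module.free_of_lTensor_residueField_injective (LinearMap.ker f).subtype f hf
      (LinearMap.exact_subtype_ker_map f) hinj
    infer_instance

theorem residue_retract {A : Type u} [CommRing A] [IsLocalRing A] [IsNoetherianRing A]
    {x : A} (hx : x ∈ maximalIdeal A) (hx2 : x ∉ maximalIdeal A ^ 2)
    [IsLocalRing (A ⧸ Ideal.span {x})] (d : ℕ)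
    (h : HasProjectiveDimensionLE (ModuleCat.of (A ⧸ Ideal.span {x})
      (QuotSMulTop x (maximalIdeal A))) d) :
    HasProjectiveDimensionLE (ModuleCat.of (A ⧸ Ideal.span {x})
      ((A ⧸ Ideal.span {x}) ⧸ maximalIdeal (A ⧸ Ideal.span {x}))) d := by
  let B := A ⧸ Ideal.span {x}
  let k' := B ⧸ maximalIdeal B
  let Q := QuotSMulTop x (maximalIdeal A)
  have hmem : ∀ a : A, a ∈ maximalIdeal A →
      Ideal.Quotient.mk (Ideal.span {x}) a ∈ maximalIdeal B := fun a ha => by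
    rw [← comap_max (x := x)] at ha; exact ha
  let q : Q := Submodule.Quotient.mk ⟨x, hx⟩
  let i : k' →ₗ[B] Q := Submodule.liftQ _ (LinearMap.toSpanSingleton B Q q) (by
    intro b hb
    obtain ⟨a, rfl⟩ := Ideal.Quotient.mk_surjective b
    have ha : a ∈ maximalIdeal A := by rw [← comap_max (x := x)]; exact hb
    rw [LinearMap.mem_ker, LinearMap.toSpanSingleton_apply]
    change algebraMap A B a • q = 0
    rw [algebraMap_smul]
    change Submodule.Quotient.mk (a • (⟨x, hx⟩ : maximalIdeal A)) = _
    rw [Submodule.Quotient.mk_eq_zero]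
    have : a • (⟨x, hx⟩ : maximalIdeal A) = x • ⟨a, ha⟩ := Subtype.ext (mul_comm _ _)
    rw [this]
    exact Submodule.smul_mem_pointwise_smul _ _ _ trivial)
  have hne : (maximalIdeal A).toCotangent ⟨x, hx⟩ ≠ 0 := fun h =>
    hx2 ((Ideal.toCotangent_eq_zero _ _).mp h)
  obtain ⟨φ, hφ⟩ := Module.Projective.exists_dual_eq_one (ResidueField A)
    (V := CotangentSpace A) (x := (maximalIdeal A).toCotangent ⟨x, hx⟩) hne
  let ψ : (A ⧸ maximalIdeal A) →ₗ[A] k' := Submodule.liftQ _ (LinearMap.toSpanSingleton A k' 1) (by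
    intro a ha
    rw [LinearMap.mem_ker, LinearMap.toSpanSingleton_apply, ← algebraMap_smul B]
    change Ideal.Quotient.mk (maximalIdeal B) (algebraMap A B a * 1) = 0
    rw [mul_one, Ideal.Quotient.eq_zero_iff_mem]
    exact hmem a ha)
  let θ : maximalIdeal A →ₗ[A] k' := ψ ∘ₗ (φ.restrictScalars A) ∘ₗ (maximalIdeal A).toCotangent
  have hθ : θ ⟨x, hx⟩ = 1 := by
    change ψ (φ _) = 1
    rw [hφ]
    change (1 : A) • (1 : k') = 1
    rw [one_smul]
  have hk' : ∀ y : k', x • y = 0 := by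
    intro y
    obtain ⟨b, rfl⟩ := Ideal.Quotient.mk_surjective y
    rw [← algebraMap_smul B]
    change Ideal.Quotient.mk (maximalIdeal B) (algebraMap A B x * b) = 0
    rw [Ideal.Quotient.eq_zero_iff_mem]
    exact Ideal.mul_mem_right _ _ (hmem x hx)
  let r0 : Q →ₗ[A] k' := Submodule.liftQ _ θ (by
    rintro _ ⟨y, _, rfl⟩
    rw [LinearMap.mem_ker]
    change θ (x • y) = 0
    rw [map_smul, hk'])
  let r : Q →ₗ[B] k' := r0.extendScalarsOfSurjective Ideal.Quotient.mk_surjective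
  have hri : r ∘ₗ i = LinearMap.id := by
    apply LinearMap.ext
    intro y
    obtain ⟨b, rfl⟩ := Ideal.Quotient.mk_surjective y
    change r (b • q) = _
    rw [map_smul]
    change b • θ ⟨x, hx⟩ = _
    rw [hθ]
    change Ideal.Quotient.mk (maximalIdeal B) (b * 1) = _
    rw [mul_one]
    rfl
  have hret : Retract (ModuleCat.of B k') (ModuleCat.of B Q) :=
    ⟨ModuleCat.ofHom i, ModuleCat.ofHom r, by rw [← ModuleCat.ofHom_comp, hri]; rfl⟩
  have h' : HasProjectiveDimensionLT (ModuleCat.of B Q) (d + 1) := h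
  exact hret.hasProjectiveDimensionLT (d + 1)

theorem serre (n : ℕ) : ∀ (A : Type u) [CommRing A] [IsLocalRing A] [IsNoetherianRing A],
    ringKrullDim A < n → (∃ d, HasProjectiveDimensionLE (ModuleCat.of A (A ⧸ maximalIdeal A)) d) →
    IsRegularLocalRing A := by
  induction n with
  | zero =>
    intro A _ _ _ h
    exact absurd h (not_lt.mpr ringKrullDim_nonneg_of_nontrivial)
  | succ n ih =>
    intro A _ _ _ hdim ⟨d, hd⟩
    have hbot : maximalIdeal A = ⊥ → IsRegularLocalRing A := by
      intro h
      let _ := (IsLocalRing.isField_iff_maximalIdeal_eq.mpr h).toField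
      apply IsRegularLocalRing.of_spanFinrank_maximalIdeal_le
      rw [h, Submodule.spanFinrank_bot]
      exact ringKrullDim_nonneg_of_nontrivial
    by_cases hm : maximalIdeal A = ⊥
    · exact hbot hm
    by_cases hass : maximalIdeal A ∈ associatedPrimes A A
    · apply hbot
      rw [AssociatedPrimes.mem_iff, isAssociatedPrime_iff] at hass
      obtain ⟨hprime, s, hs⟩ := hass
      have hs0 : s ≠ 0 := fun h => hprime.ne_top (by rw [hs]; simp [h])
      have hproj := proj_of_socle hs0 (fun a ha => by
        rw [hs, Submodule.mem_colon_singleton, Submodule.mem_bot] at ha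
        rw [mul_comm]; exact ha) d _ hd
      have hfree : Module.Free A (A ⧸ maximalIdeal A) := Module.free_of_flat_of_isLocalRing
      have : Nontrivial (A ⧸ maximalIdeal A) := Ideal.Quotient.nontrivial_iff.mpr hprime.ne_top
      rw [eq_bot_iff]
      intro a ha
      have : FaithfulSMul A (A ⧸ maximalIdeal A) := inferInstance
      refine this.eq_of_smul_eq_smul (m₁ := a) (m₂ := 0) fun y => ?_
      obtain ⟨b, rfl⟩ := Ideal.Quotient.mk_surjective y
      rw [zero_smul]
      change Ideal.Quotient.mk _ (a * b) = 0
      rw [Ideal.Quotient.eq_zero_iff_mem]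
      exact Ideal.mul_mem_right _ _ ha
    · obtain ⟨x, hx, hx2, hxp⟩ := exists_avoid hm (associatedPrimes.finite A A)
        (fun p hp => hp.1) hass
      have hnz : x ∈ nonZeroDivisors A := by
        by_contra h
        have : x ∈ (nonZeroDivisors A : Set A)ᶜ := h
        rw [← biUnion_associatedPrimes_eq_compl_nonZeroDivisors] at this
        obtain ⟨p, hp, hxp'⟩ := Set.mem_iUnion₂.mp this
        exact hxp p hp hxp'
      have hxA : IsSMulRegular A x := fun a b hab =>
        (mul_cancel_left_mem_nonZeroDivisors hnz).mp hab
      have hloc := quot_isLocal hx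
      have hdq := ringKrullDim_quotient_span_singleton_succ_eq_ringKrullDim_of_mem_nonZeroDivisors
        hnz hx
      have hd1 : HasProjectiveDimensionLE (ModuleCat.of A (maximalIdeal A)) d := by
        refine (pd_succ_iff (maximalIdeal A).subtype (maximalIdeal A).mkQ Subtype.val_injective
          (LinearMap.exact_subtype_mkQ _) (Submodule.mkQ_surjective _) d).mp (pd_mono (Nat.le_succ d) hd)
      rw [← pd_quot_iff hx hxA d (maximalIdeal A)
        (fun a b hab => Subtype.ext (hxA (congrArg Subtype.val hab)))] at hd1
      have hres := residue_retract hx hx2 d hd1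
      have hreg := ih (A ⧸ Ideal.span {x}) (by
        rw [← hdq] at hdim
        by_contra h
        push Not at h
        refine absurd hdim (not_lt.mpr ?_)
        push_cast
        gcongr) ⟨d, hres⟩
      apply IsRegularLocalRing.of_spanFinrank_maximalIdeal_le
      rw [← hdq, ← (isRegularLocalRing_iff _).mp hreg]
      exact_mod_cast spanFinrank_le_quot hx

theorem serre' (A : Type u) [CommRing A] [IsLocalRing A] [IsNoetherianRing A]
    (h : ∃ d, HasProjectiveDimensionLE (ModuleCat.of A (A ⧸ maximalIdeal A)) d) :
    IsRegularLocalRing A :=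
  serre ((maximalIdeal A).spanFinrank + 1) A
    (lt_of_le_of_lt (ringKrullDim_le_spanFinrank_maximalIdeal A)
      (by exact_mod_cast Nat.lt_succ_self _)) h
end SE

section TV

theorem tor_exact {A : Type u} [CommRing A] (Q : ℕ → Type u) [∀ i, AddCommGroup (Q i)]
    [∀ i, Module A (Q i)] [∀ i, Module.Flat A (Q i)] (d : ∀ i, Q (i + 1) →ₗ[A] Q i)
    (hd : ∀ i, Function.Exact (d (i + 1)) (d i)) (n : ℕ) :
    ∀ (M : Type u) [AddCommGroup M] [Module A M], ProjDimLE A n M → ∀ i ≥ n,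
      Function.Exact ((d (i + 1)).lTensor M) ((d i).lTensor M) := by
  have hdd : ∀ (M : Type u) [AddCommGroup M] [Module A M] (i : ℕ) z,
      (d i).lTensor M ((d (i + 1)).lTensor M z) = 0 := by
    intro M _ _ i z
    rw [← LinearMap.comp_apply, ← LinearMap.lTensor_comp, (hd i).linearMap_comp_eq_zero,
      LinearMap.lTensor_zero, LinearMap.zero_apply]
  induction n with
  | zero =>
    intro M _ _ h i _
    have : Module.Projective A M := h
    exact Module.Flat.lTensor_exact M (hd i)
  | succ n ih =>
    intro M _ _ h i hi
    obtain ⟨P, _, _, hP, π, hπ, hK⟩ := h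
    obtain ⟨i, rfl⟩ : ∃ j, i = j + 1 := ⟨i - 1, by omega⟩
    have hE := ih _ hK i (by omega)
    let ι := (LinearMap.ker π).subtype
    have hιπ : Function.Exact ι π := LinearMap.exact_subtype_ker_map π
    have comm : ∀ {X Y : Type u} [AddCommGroup X] [Module A X] [AddCommGroup Y] [Module A Y]
        (f : X →ₗ[A] Y) (j : ℕ) (z : TensorProduct A X (Q (j + 1))),
        (d j).lTensor Y (f.rTensor _ z) = f.rTensor _ ((d j).lTensor X z) := by
      intro X Y _ _ _ _ f j z
      rw [← LinearMap.comp_apply, LinearMap.lTensor_comp_rTensor,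
        ← LinearMap.rTensor_comp_lTensor, LinearMap.comp_apply]
    intro z
    refine ⟨fun hz => ?_, ?_⟩
    · obtain ⟨y, rfl⟩ := LinearMap.rTensor_surjective (Q (i + 1 + 1)) hπ z
      rw [comm] at hz
      obtain ⟨w, hw⟩ := (rTensor_exact (Q (i + 1)) hιπ hπ _).mp hz
      have hinj : Function.Injective (ι.rTensor (Q i)) :=
        Module.Flat.rTensor_preserves_injective_linearMap ι Subtype.val_injective
      have hw0 : (d i).lTensor _ w = 0 := by
        apply hinj
        rw [← comm, hw, hdd, map_zero]
      obtain ⟨w', rfl⟩ := (hE w).mp hw0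
      have hy : (d (i + 1)).lTensor P (y - ι.rTensor _ w') = 0 := by
        rw [map_sub, comm, hw, sub_self]
      obtain ⟨y', hy'⟩ := (Module.Flat.lTensor_exact P (hd (i + 1)) _).mp hy
      refine ⟨π.rTensor _ y', ?_⟩
      rw [comm, hy', map_sub, sub_eq_self]
      exact (rTensor_exact (Q (i + 1 + 1)) hιπ hπ _).mpr ⟨w', rfl⟩
    · rintro ⟨y, rfl⟩
      exact hdd _ _ _

theorem torVanish_of_projDimLE {A : Type u} [CommRing A] (n : ℕ) (M N : Type u)
    [AddCommGroup M] [Module A M] [AddCommGroup N] [Module A N] (h : ProjDimLE A n M)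
    (i : ℕ) (hi : n + 1 ≤ i) : TorVanish A i M N := by
  obtain ⟨j, rfl⟩ : ∃ j, i = j + 1 := ⟨i - 1, by omega⟩
  unfold TorVanish
  rw [← ModuleCat.isZero_iff_subsingleton]
  let P := projectiveResolution (ModuleCat.of A N)
  let F := (MonoidalCategory.tensoringLeft (ModuleCat.{u} A)).obj (ModuleCat.of A M)
  refine Limits.IsZero.of_iso ?_ (P.isoLeftDerivedObj F (j + 1))
  change Limits.IsZero (HomologicalComplex.homology _ _)
  rw [← HomologicalComplex.exactAt_iff_isZero_homology,
    HomologicalComplex.exactAt_iff' _ (j + 2) (j + 1) j (by simp) (by simp),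
    ShortComplex.ShortExact.moduleCat_exact_iff_function_exact]
  have hflat : ∀ k, Module.Flat A (P.complex.X k) := fun k => by
    have : Module.Projective A (P.complex.X k) := (IsProjective.iff_projective (R := A) (P.complex.X k)).mpr (P.projective k)
    infer_instance
  refine tor_exact (fun k => P.complex.X k) (fun k => (P.complex.d (k + 1) k).hom) ?_ n M h j
    (by omega)
  intro k
  have := P.complex_exactAt_succ k
  rw [HomologicalComplex.exactAt_iff' _ (k + 2) (k + 1) k (by simp) (by simp),
    ShortComplex.ShortExact.moduleCat_exact_iff_function_exact] at this
  exact this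

theorem backward (A : Type u) [CommRing A] [IsLocalRing A] [IsNoetherianRing A]
    (h : ∃ (M : Type u) (_ : AddCommGroup M) (_ : Module A M),
      Module.Finite A M ∧ IsTestModule A M ∧ ∃ n : ℕ, ProjDimLE A n M) : IsRegularLocal A := by
  obtain ⟨M, _, _, _, hT, n, hn⟩ := h
  obtain ⟨d, hd⟩ := hT A (by rw [Algebra.algebraMap_self]; infer_instance) (A ⧸ maximalIdeal A) inferInstance
    ⟨n + 1, fun i hi => torVanish_of_projDimLE n M _ hn i hi⟩
  exact isRegularLocal_iff.mpr (serre' A ⟨d, pd_of_flatDimLE d _ hd⟩)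
end TV

/-- Theorem `R` of the paper. A noetherian local ring `A` is regular
if and only if there exists a test module for `A` of finite projective dimension. -/
theorem isRegularLocal_iff_exists_test_module_of_finite_projDim
    (A : Type u) [CommRing A] [IsLocalRing A] [IsNoetherianRing A] :
    IsRegularLocal A ↔
      ∃ (M : Type u) (_ : AddCommGroup M) (_ : Module A M),
        Module.Finite A M ∧ IsTestModule A M ∧ ∃ n : ℕ, ProjDimLE A n M := by
  exact ⟨forward A, backward A⟩
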